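/- Let $V$ be a 4-dimensional oriented Lorentzian vector space, $\ell, k$ null vectors with $\ell^a k_a = -1$ orthogonal to a spacelike 2-plane. Let $F_{ab}$ be an antisymmetric 2-tensor whose pull-back to the 2-plane is proportional to its area form, and let $T^{EM}_{ab} = \frac{1}{4\pi}(F_{ac}F_b{}^c - \frac{1}{4}g_{ab}F_{cd}F^{cd})$. Then $T^{EM}_{ab}\ell^a k^b = \frac{1}{8\pi}\left[(\ell^a k^b F_{ab})^2 + (\ell^a k^b\, {}^*F_{ab})^2\right]$. -/

import Mathlib

open scoped Matrix

/-- A (symmetric) Lorentzian metric of signature `(-,+,+,+)` on `ℝ⁴`,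
presented in components. -/
def IsLorentzian (g : Matrix (Fin 4) (Fin 4) ℝ) : Prop :=
  g.IsSymm ∧ ∃ P : Matrix (Fin 4) (Fin 4) ℝ, IsUnit P.det ∧
    Pᵀ * g * P = Matrix.diagonal ![(-1 : ℝ), 1, 1, 1]

/-- Index lowering: `v_a = g_{ab} v^b`. -/
def lowerIdx (g : Matrix (Fin 4) (Fin 4) ℝ) (v : Fin 4 → ℝ) (a : Fin 4) : ℝ :=
  ∑ b, g a b * v b

/-- Raising both indices: `T^{ab} = g^{ac} g^{bd} T_{cd}`. -/
def raise2 (ginv T : Matrix (Fin 4) (Fin 4) ℝ) (a b : Fin 4) : ℝ :=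
  ∑ c, ∑ d, ginv a c * ginv b d * T c d

/-- The Levi-Civita symbol on `Fin 4`, via a determinant of standard basis
vectors. -/
def lcSymbol (a b c d : Fin 4) : ℝ :=
  Matrix.det (Matrix.of ![Pi.single a (1 : ℝ), Pi.single b 1,
    Pi.single c 1, Pi.single d 1])

/-- The spacetime volume form `ε_{abcd}` of an (oriented) Lorentzian metric
`g`, in components. -/
noncomputable def volForm (g : Matrix (Fin 4) (Fin 4) ℝ)
    (a b c d : Fin 4) : ℝ :=
  Real.sqrt (-g.det) * lcSymbol a b c d

/-- The area 2-form `ε_{ab} = ε_{abcd} ℓ^c k^d` of the spacelike 2-plane. -/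
noncomputable def areaForm (g : Matrix (Fin 4) (Fin 4) ℝ) (ℓ k : Fin 4 → ℝ)
    (a b : Fin 4) : ℝ :=
  ∑ c, ∑ d, volForm g a b c d * ℓ c * k d

/-- The Hodge dual `*F_{ab} = ½ ε_{abcd} F^{cd}`. -/
noncomputable def hodgeDual (g ginv F : Matrix (Fin 4) (Fin 4) ℝ)
    (a b : Fin 4) : ℝ :=
  (1 / 2) * ∑ c, ∑ d, volForm g a b c d * raise2 ginv F c d

/-- The electromagnetic energy-momentum tensor
`T_{ab} = (1/4π)(F_{ac} F_b{}^c - ¼ g_{ab} F_{cd} F^{cd})`. -/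
noncomputable def EMtensor (g ginv F : Matrix (Fin 4) (Fin 4) ℝ) :
    Matrix (Fin 4) (Fin 4) ℝ :=
  Matrix.of fun a b => (1 / (4 * Real.pi)) *
    ((∑ c, F a c * (∑ d, ginv c d * F b d)) -
      (1 / 4) * g a b *
        (∑ c, ∑ d, ∑ e, ∑ f, F c d * ginv c e * ginv d f * F e f))

/-- Determinant of four row vectors. -/
def D4 (x y z w : Fin 4 → ℝ) : ℝ := Matrix.det (Matrix.of ![x, y, z, w])

lemma D4_eq (x y z w : Fin 4 → ℝ) : D4 x y z w =
    (x 0 * y 1 - x 1 * y 0) * (z 2 * w 3 - z 3 * w 2)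
    - (x 0 * y 2 - x 2 * y 0) * (z 1 * w 3 - z 3 * w 1)
    + (x 0 * y 3 - x 3 * y 0) * (z 1 * w 2 - z 2 * w 1)
    + (x 1 * y 2 - x 2 * y 1) * (z 0 * w 3 - z 3 * w 0)
    - (x 1 * y 3 - x 3 * y 1) * (z 0 * w 2 - z 2 * w 0)
    + (x 2 * y 3 - x 3 * y 2) * (z 0 * w 1 - z 1 * w 0) := by
  unfold D4
  rw [Matrix.det_succ_row_zero]
  simp [Fin.sum_univ_four, Matrix.det_fin_three, Fin.succAbove, Matrix.submatrix_apply]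
  ring

lemma D4_lin4 (x y z w : Fin 4 → ℝ) :
    ∑ d, w d * D4 x y z (Pi.single d 1) = D4 x y z w := by
  simp [D4_eq, Fin.sum_univ_four, Pi.single_apply]
  ring

lemma D4_lin3 (x y z w : Fin 4 → ℝ) :
    ∑ d, z d * D4 x y (Pi.single d 1) w = D4 x y z w := by
  simp [D4_eq, Fin.sum_univ_four, Pi.single_apply]
  ring

lemma D4_lin2 (x y z w : Fin 4 → ℝ) :
    ∑ d, y d * D4 x (Pi.single d 1) z w = D4 x y z w := by
  simp [D4_eq, Fin.sum_univ_four, Pi.single_apply]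
  ring

lemma D4_lin1 (x y z w : Fin 4 → ℝ) :
    ∑ d, x d * D4 (Pi.single d 1) y z w = D4 x y z w := by
  simp [D4_eq, Fin.sum_univ_four, Pi.single_apply]
  ring

/-- The bilinear form of `g`. -/
def bil (g : Matrix (Fin 4) (Fin 4) ℝ) (x y : Fin 4 → ℝ) : ℝ := ∑ a, ∑ b, g a b * x a * y b

lemma bil_symm (g : Matrix (Fin 4) (Fin 4) ℝ) (h : g.IsSymm) (x y : Fin 4 → ℝ) :
    bil g x y = bil g y x := by
  unfold bil
  rw [Finset.sum_comm]
  refine Finset.sum_congr rfl fun a _ => Finset.sum_congr rfl fun b _ => ?_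
  rw [h.apply a b]; ring

lemma bil_lin (g : Matrix (Fin 4) (Fin 4) ℝ) (x y z w : Fin 4 → ℝ) (s t : ℝ) :
    bil g w (x + s • y + t • z) = bil g w x + s * bil g w y + t * bil g w z := by
  simp only [bil, Finset.mul_sum, ← Finset.sum_add_distrib]
  refine Finset.sum_congr rfl fun a _ => Finset.sum_congr rfl fun b _ => ?_
  simp; ring

lemma minors (g : Matrix (Fin 4) (Fin 4) ℝ) (x y : Fin 4 → ℝ)
    (h : ∀ a b, x a * y b = x b * y a) :
    bil g x y * bil g x y = bil g x x * bil g y y := by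
  simp only [bil, Finset.sum_mul_sum]
  refine Finset.sum_congr rfl fun a _ => Finset.sum_congr rfl fun b _ =>
    Finset.sum_congr rfl fun c _ => Finset.sum_congr rfl fun d _ => ?_
  linear_combination (-g a c * x a * g b d * y d) * h c b

lemma exists_frame (g : Matrix (Fin 4) (Fin 4) ℝ) (hs : g.IsSymm) (l k : Fin 4 → ℝ)
    (hll : bil g l l = 0) (hkk : bil g k k = 0) (hlk : bil g l k = -1) :
    ∃ u v : Fin 4 → ℝ, D4 l k u v ≠ 0 ∧ bil g l u = 0 ∧ bil g k u = 0 ∧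
      bil g l v = 0 ∧ bil g k v = 0 := by
  have hkl : bil g k l = -1 := by rw [bil_symm g hs, hlk]
  have h0 : ∃ u v : Fin 4 → ℝ, D4 l k u v ≠ 0 := by
    by_contra! h
    have e (i j : Fin 4) := h (Pi.single i 1) (Pi.single j 1)
    have := minors g l k (by
      have e01 := e 0 1
      have e02 := e 0 2
      have e03 := e 0 3
      have e12 := e 1 2
      have e13 := e 1 3
      have e23 := e 2 3
      simp [D4_eq] at e01 e02 e03 e12 e13 e23
      intro a b
      fin_cases a <;> fin_cases b <;> simp <;> linarith)
    rw [hll, hkk, hlk] at this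
    norm_num at this
  obtain ⟨u, v, h⟩ := h0
  refine ⟨u + bil g k u • l + bil g l u • k, v + bil g k v • l + bil g l v • k, ?_, ?_, ?_, ?_, ?_⟩
  · convert h using 1
    simp only [D4_eq, Pi.add_apply, Pi.smul_apply, smul_eq_mul]
    ring
  all_goals simp [bil_lin, hll, hkk, hlk, hkl]

lemma sandwich (A M : Matrix (Fin 4) (Fin 4) ℝ) (i j : Fin 4) :
    (A * M * Aᵀ) i j = bil M (A i) (A j) := by
  simp only [Matrix.mul_apply, bil, Finset.sum_mul, Matrix.transpose_apply]
  rw [Finset.sum_comm]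
  refine Finset.sum_congr rfl fun a _ => Finset.sum_congr rfl fun b _ => ?_
  ring

lemma hodge_eq (s : ℝ) (R : Matrix (Fin 4) (Fin 4) ℝ) (x y : Fin 4 → ℝ) :
    ∑ a, ∑ b, x a * y b * ((1 / 2) * ∑ c, ∑ d, s * lcSymbol a b c d * R c d) =
      (s / 2) * ∑ c, ∑ d, R c d * D4 x y (Pi.single c 1) (Pi.single d 1) := by
  have h : ∀ c d, D4 x y (Pi.single c 1) (Pi.single d 1) =
      ∑ a, ∑ b, x a * y b * lcSymbol a b c d := by
    intro c d
    rw [← D4_lin1]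
    refine Finset.sum_congr rfl fun a _ => ?_
    rw [← D4_lin2, Finset.mul_sum]
    refine Finset.sum_congr rfl fun b _ => ?_
    rw [lcSymbol, D4]; ring
  simp only [h, Fin.sum_univ_four]
  ring

lemma D4_frame (A N : Matrix (Fin 4) (Fin 4) ℝ) (x y : Fin 4 → ℝ) :
    ∑ c, ∑ d, (Aᵀ * N * A) c d * D4 x y (Pi.single c 1) (Pi.single d 1) =
      ∑ m, ∑ n, N m n * D4 x y (A m) (A n) := by
  have h : ∀ m n, D4 x y (A m) (A n) =
      ∑ c, ∑ d, A m c * A n d * D4 x y (Pi.single c 1) (Pi.single d 1) := by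
    intro m n
    rw [← D4_lin3]
    refine Finset.sum_congr rfl fun a _ => ?_
    rw [← D4_lin4, Finset.mul_sum]
    refine Finset.sum_congr rfl fun b _ => ?_
    ring
  simp only [h, Matrix.mul_apply, Fin.sum_univ_four, Matrix.transpose_apply]
  ring

lemma em_eq (g ginv F : Matrix (Fin 4) (Fin 4) ℝ) (x y : Fin 4 → ℝ) :
    (∑ a, ∑ b, EMtensor g ginv F a b * x a * y b) =
    (1 / (4 * Real.pi)) * (bil (F * ginv * Fᵀ) x y - (1 / 4) * bil g x y *
      (Fᵀ * ginv * F * ginvᵀ).trace) := by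
  have h1 : ∀ a b, ∑ c, F a c * (∑ d, ginv c d * F b d) = (F * ginv * Fᵀ) a b := by
    intro a b
    rw [Matrix.mul_assoc]
    simp only [Matrix.mul_apply, Matrix.transpose_apply]
  have h2 : (∑ c, ∑ d, ∑ e, ∑ f, F c d * ginv c e * ginv d f * F e f) =
      (Fᵀ * ginv * F * ginvᵀ).trace := by
    simp only [Matrix.trace, Matrix.diag, Matrix.mul_apply, Matrix.transpose_apply, Finset.sum_mul]
    rw [Finset.sum_comm]
    refine Finset.sum_congr rfl fun d _ => ?_
    simp only [Fin.sum_univ_four]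
    ring
  simp only [EMtensor, Matrix.of_apply, h1, h2]
  simp only [bil, Finset.mul_sum, Finset.sum_mul, ← Finset.sum_sub_distrib]
  refine Finset.sum_congr rfl fun a _ => Finset.sum_congr rfl fun b _ => ?_
  ring

/-- Lemma 3.3 of the paper:
`T^{EM}_{ab} ℓ^a k^b = (1/8π)[(ℓ^a k^b F_{ab})² + (ℓ^a k^b *F_{ab})²]`
for null `ℓ, k` with `g(ℓ,k) = -1` orthogonal to a spacelike 2-plane, when the
pull-back of `F` to the 2-plane is proportional to its area form. -/
theorem area_charge_stmt8 (g ginv : Matrix (Fin 4) (Fin 4) ℝ)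
    (hg : IsLorentzian g) (hinv : g * ginv = 1)
    (ℓ k : Fin 4 → ℝ)
    (hℓnull : ∑ a, ∑ b, g a b * ℓ a * ℓ b = 0)
    (hknull : ∑ a, ∑ b, g a b * k a * k b = 0)
    (hℓk : ∑ a, ∑ b, g a b * ℓ a * k b = -1)
    (q : Matrix (Fin 4) (Fin 4) ℝ) (hq : q.PosSemidef)
    (hqℓ : ∀ a, ∑ b, q a b * ℓ b = 0) (hqk : ∀ a, ∑ b, q a b * k b = 0)
    (hdec : ∀ a b, g a b = q a b - lowerIdx g ℓ a * lowerIdx g k b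
      - lowerIdx g ℓ b * lowerIdx g k a)
    (F : Matrix (Fin 4) (Fin 4) ℝ) (hF : ∀ a b, F b a = -F a b)
    (hpull : ∃ lam : ℝ, ∀ a b,
      (∑ c, ∑ d, (∑ e, ginv c e * q e a) * (∑ f, ginv d f * q f b) * F c d) =
        lam * areaForm g ℓ k a b) :
    (∑ a, ∑ b, EMtensor g ginv F a b * ℓ a * k b) =
      (1 / (8 * Real.pi)) *
        ((∑ a, ∑ b, ℓ a * k b * F a b) ^ 2 +
          (∑ a, ∑ b, ℓ a * k b * hodgeDual g ginv F a b) ^ 2) := by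
  obtain ⟨hs, P, hP, hPg⟩ := hg
  obtain ⟨u, v, hD, hlu, hku, hlv, hkv⟩ := exists_frame g hs ℓ k hℓnull hknull hℓk
  have hdet : g.det * P.det ^ 2 = -1 := by
    have := congrArg Matrix.det hPg
    simp [Matrix.det_mul, Fin.prod_univ_four] at this
    linarith
  have hneg : 0 < -g.det := by
    by_contra hc
    nlinarith [sq_nonneg P.det]
  set A : Matrix (Fin 4) (Fin 4) ℝ := Matrix.of ![ℓ, k, u, v] with hA
  have hA0 : A 0 = ℓ := rfl
  have hA1 : A 1 = k := rfl
  have hA2 : A 2 = u := rfl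
  have hA3 : A 3 = v := rfl
  have hAdet : A.det = D4 ℓ k u v := rfl
  obtain ⟨a, ha⟩ : ∃ a, a = bil g u u := ⟨_, rfl⟩
  obtain ⟨b, hb⟩ : ∃ b, b = bil g u v := ⟨_, rfl⟩
  obtain ⟨c, hc⟩ : ∃ c, c = bil g v v := ⟨_, rfl⟩
  have hll : bil g ℓ ℓ = 0 := hℓnull
  have hkk : bil g k k = 0 := hknull
  have hlk : bil g ℓ k = -1 := hℓk
  have hG : A * g * Aᵀ = !![0, -1, 0, 0; -1, 0, 0, 0; 0, 0, a, b; 0, 0, b, c] := by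
    ext i j
    rw [sandwich]
    fin_cases i <;> fin_cases j <;>
      simp [hA0, hA1, hA2, hA3, hll, hkk, hlk, hlu, hku, hlv, hkv, bil_symm g hs k ℓ,
        bil_symm g hs u ℓ, bil_symm g hs u k, bil_symm g hs v ℓ, bil_symm g hs v k,
        bil_symm g hs v u, ha, hb, hc]
  have hdetG : g.det * D4 ℓ k u v ^ 2 = -(a * c - b ^ 2) := by
    have := congrArg Matrix.det hG
    rw [Matrix.det_mul, Matrix.det_mul, Matrix.det_transpose, hAdet] at this
    have e : Matrix.det !![0, -1, 0, 0; -1, 0, 0, 0; 0, 0, a, b; 0, 0, b, c] =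
      D4 ![0, -1, 0, 0] ![-1, 0, 0, 0] ![0, 0, a, b] ![0, 0, b, c] := rfl
    have e2 : D4 ![0, -1, 0, 0] ![-1, 0, 0, 0] ![0, 0, a, b] ![0, 0, b, c] =
        -(a * c - b ^ 2) := by
      rw [D4_eq]
      simp
      ring
    rw [e, e2] at this
    linarith
  obtain ⟨Δ, hΔ⟩ : ∃ Δ, Δ = a * c - b ^ 2 := ⟨_, rfl⟩
  have hΔ0 : Δ ≠ 0 := by
    have : 0 < D4 ℓ k u v ^ 2 := by positivity
    have : 0 < -g.det * D4 ℓ k u v ^ 2 := by positivity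
    intro h
    rw [← hΔ, h] at hdetG
    linarith
  obtain ⟨H, hH⟩ : ∃ H : Matrix (Fin 4) (Fin 4) ℝ,
    H = !![0, -1, 0, 0; -1, 0, 0, 0; 0, 0, c / Δ, -b / Δ; 0, 0, -b / Δ, a / Δ] := ⟨_, rfl⟩
  have hGH : A * g * Aᵀ * H = 1 := by
    rw [hG, hH]
    ext i j
    fin_cases i <;> fin_cases j <;>
      simp [Matrix.mul_apply, Fin.sum_univ_four] <;> field_simp <;> rw [hΔ] <;> ring
  have hginv : ginv = Aᵀ * H * A := by
    have h1 : A * (g * Aᵀ * H) = 1 := by simpa [Matrix.mul_assoc] using hGH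
    have h2 : g * (Aᵀ * H * A) = 1 := by
      simpa [Matrix.mul_assoc] using mul_eq_one_comm.mp h1
    have h3 : ginv * g = 1 := mul_eq_one_comm.mp hinv
    calc ginv = ginv * (g * (Aᵀ * H * A)) := by rw [h2, mul_one]
      _ = (ginv * g) * (Aᵀ * H * A) := by rw [Matrix.mul_assoc ginv]
      _ = _ := by rw [h3, one_mul]
  obtain ⟨f, hf⟩ : ∃ f : Matrix (Fin 4) (Fin 4) ℝ, f = A * F * Aᵀ := ⟨_, rfl⟩
  have hFt : Fᵀ = -F := by ext i j; simp [hF i j]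
  have hft : fᵀ = -f := by
    rw [hf]; simp [Matrix.transpose_mul, hFt, Matrix.mul_assoc]
  have hfa : ∀ i j, f j i = -f i j := fun i j => by
    have := congrFun (congrFun hft i) j
    simpa using this
  have hfd : ∀ i, f i i = 0 := fun i => by linarith [hfa i i]
  have hT1 : bil (F * ginv * Fᵀ) ℓ k = (f * H * fᵀ) 0 1 := by
    rw [← hA0, ← hA1, ← sandwich, hginv, hf]
    simp only [Matrix.transpose_mul, Matrix.transpose_transpose, Matrix.mul_assoc]
  have hT2 : (Fᵀ * ginv * F * ginvᵀ).trace = (fᵀ * H * f * Hᵀ).trace := by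
    rw [hginv, hf]
    simp only [Matrix.transpose_mul, Matrix.transpose_transpose]
    rw [show Fᵀ * (Aᵀ * H * A) * F * (Aᵀ * (Hᵀ * A)) =
      (Fᵀ * Aᵀ * H * A * F * Aᵀ * Hᵀ) * A by simp only [Matrix.mul_assoc], Matrix.trace_mul_comm]
    simp only [Matrix.mul_assoc]
  have hE : (∑ a, ∑ b, ℓ a * k b * F a b) = f 0 1 := by
    rw [hf, sandwich, hA0, hA1, bil]
    refine Finset.sum_congr rfl fun a _ => Finset.sum_congr rfl fun b _ => ?_
    ring
  have hB : (∑ a, ∑ b, ℓ a * k b * hodgeDual g ginv F a b) =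
      Real.sqrt (-g.det) * D4 ℓ k u v * (f 2 3 / Δ) := by
    have hR : ∀ c d, raise2 ginv F c d = (Aᵀ * (H * f * Hᵀ) * A) c d := by
      intro c d
      have : Aᵀ * (H * f * Hᵀ) * A = ginv * F * ginvᵀ := by
        rw [hginv, hf]
        simp only [Matrix.transpose_mul, Matrix.transpose_transpose, Matrix.mul_assoc]
      rw [this, sandwich, raise2, bil]
      refine Finset.sum_congr rfl fun a _ => Finset.sum_congr rfl fun b _ => ?_
      ring
    simp only [hodgeDual, volForm, hR]
    rw [hodge_eq, D4_frame]
    have hsum : ∑ m, ∑ n, (H * f * Hᵀ) m n * D4 ℓ k (A m) (A n) =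
        ((H * f * Hᵀ) 2 3 - (H * f * Hᵀ) 3 2) * D4 ℓ k u v := by
      simp only [Fin.sum_univ_four, hA0, hA1, hA2, hA3, D4_eq]
      ring
    have h23 : (H * f * Hᵀ) 2 3 - (H * f * Hᵀ) 3 2 = 2 * (f 2 3 / Δ) := by
      simp only [Matrix.mul_apply, Fin.sum_univ_four, Matrix.transpose_apply]
      simp [hH, hfd, hfa 2 3]
      field_simp
      rw [hΔ]; ring
    rw [hsum, h23]; ring
  have hB2 : (Real.sqrt (-g.det) * D4 ℓ k u v * (f 2 3 / Δ)) ^ 2 = f 2 3 ^ 2 / Δ := by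
    rw [mul_pow, mul_pow, Real.sq_sqrt hneg.le, show -g.det * D4 ℓ k u v ^ 2 = Δ by
      rw [hΔ]; linarith]
    field_simp
  rw [em_eq, hE, hB, hB2, hT1, hT2, hlk]
  have key : (f * H * fᵀ) 0 1 - 1 / 4 * -1 * (fᵀ * H * f * Hᵀ).trace =
      (1 / 2) * (f 0 1 ^ 2 + f 2 3 ^ 2 / Δ) := by
    simp only [Matrix.mul_apply, Matrix.trace, Fin.sum_univ_four, Matrix.transpose_apply, Matrix.diag]
    simp [hH, hfd, hfa 0 1, hfa 0 2, hfa 0 3,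
      hfa 1 2, hfa 1 3, hfa 2 3]
    field_simp
    rw [hΔ]; ring
  rw [key]
  ring
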